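/- For every position (a,b) ∈ ℕ×ℕ that does not belong to the set {(A_n, B_n) : n ≥ 0} ∪ {(B_n, A_n) : n ≥ 0}, there exists a legal move in Wythoff's game from (a,b) to some position in that set. -/

import Mathlib

noncomputable def phi : ℝ := (1 + Real.sqrt 5) / 2
noncomputable def wA (n : ℕ) : ℕ := ⌊phi * n⌋₊
noncomputable def wB (n : ℕ) : ℕ := ⌊phi ^ 2 * n⌋₊

/-- A legal move in Wythoff's game from `p` to `q`. -/
def WythoffMove (p q : ℕ × ℕ) : Prop :=
  (∃ t, 1 ≤ t ∧ t ≤ p.1 ∧ q = (p.1 - t, p.2)) ∨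
  (∃ t, 1 ≤ t ∧ t ≤ p.2 ∧ q = (p.1, p.2 - t)) ∨
  (∃ s, 1 ≤ s ∧ s ≤ min p.1 p.2 ∧ q = (p.1 - s, p.2 - s))

/-- `S` is the set of P-positions of the game with move relation `move`. -/
def IsPPositions (move : ℕ × ℕ → ℕ × ℕ → Prop) (S : Set (ℕ × ℕ)) : Prop :=
  (∀ p ∈ S, ∀ q ∈ S, ¬ move p q) ∧ (∀ p ∉ S, ∃ q ∈ S, move p q)

theorem phi_sq : phi ^ 2 = phi + 1 := Real.goldenRatio_sq

theorem one_lt_phi : 1 < phi := Real.one_lt_goldenRatio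

theorem phi_pos : 0 < phi := Real.goldenRatio_pos

theorem phi_holderConjugate_phi_sq : phi.HolderConjugate (phi ^ 2) := by
  rw [Real.holderConjugate_iff]
  refine ⟨one_lt_phi, ?_⟩
  have h := phi_pos.ne'
  field_simp
  exact phi_sq.symm

theorem wB_eq (n : ℕ) : wB n = wA n + n := by
  have h : 0 ≤ phi * n := mul_nonneg phi_pos.le n.cast_nonneg
  rw [wB, wA, phi_sq, add_mul, one_mul, Nat.floor_add_natCast h]

theorem wA_strictMono : StrictMono wA := by
  refine strictMono_nat_of_lt_succ fun n => ?_
  have h : 0 ≤ phi * n := mul_nonneg phi_pos.le n.cast_nonneg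
  have h1 : wA n + 1 ≤ wA (n + 1) := by
    rw [wA, wA, ← Nat.floor_add_one h]
    apply Nat.floor_le_floor
    push_cast
    linarith [one_lt_phi]
  omega

theorem natFloor_mul_of_beattySeq_eq {r : ℝ} {k : ℤ} (hk : 0 < k) {m : ℕ}
    (h : beattySeq r k = m) : ⌊r * (k.toNat : ℝ)⌋₊ = m := by
  have hcast : (k.toNat : ℝ) = k := by exact_mod_cast Int.toNat_of_nonneg hk.le
  rw [beattySeq] at h
  rw [hcast, mul_comm, ← Int.floor_toNat, h, Int.toNat_natCast]

/-- The two Wythoff sequences together cover the natural numbers. -/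
theorem exists_eq_wA_or_eq_wB (m : ℕ) : ∃ n, m = wA n ∨ m = wB n := by
  rcases Nat.eq_zero_or_pos m with rfl | hm
  · exact ⟨0, Or.inl (by simp [wA])⟩
  have hirr : Irrational phi := Real.goldenRatio_irrational
  have hmem : (m : ℤ) ∈ {n : ℤ | 0 < n} := Int.natCast_pos.mpr hm
  rw [← hirr.beattySeq_symmDiff_beattySeq_pos phi_holderConjugate_phi_sq,
    Set.mem_symmDiff] at hmem
  rcases hmem with ⟨⟨k, hk, h⟩, -⟩ | ⟨⟨k, hk, h⟩, -⟩
  · exact ⟨k.toNat, Or.inl (natFloor_mul_of_beattySeq_eq hk h).symm⟩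
  · exact ⟨k.toNat, Or.inr (natFloor_mul_of_beattySeq_eq hk h).symm⟩

theorem WythoffMove.swap {p q : ℕ × ℕ} (h : WythoffMove p q) : WythoffMove p.swap q.swap := by
  rcases h with ⟨t, h1, h2, rfl⟩ | ⟨t, h1, h2, rfl⟩ | ⟨s, h1, h2, rfl⟩
  · exact Or.inr (Or.inl ⟨t, h1, h2, rfl⟩)
  · exact Or.inl ⟨t, h1, h2, rfl⟩
  · exact Or.inr (Or.inr ⟨s, h1, by rwa [min_comm] at h2, rfl⟩)

theorem exists_wythoffMove_of_le {a b : ℕ} (hab : a ≤ b)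
    (h₁ : ∀ n, (a, b) ≠ (wA n, wB n)) (h₂ : ∀ n, (a, b) ≠ (wB n, wA n)) :
    ∃ n, WythoffMove (a, b) (wA n, wB n) ∨ WythoffMove (a, b) (wB n, wA n) := by
  obtain ⟨n, rfl | rfl⟩ := exists_eq_wA_or_eq_wB a
  · have hne : b ≠ wB n := fun h => h₁ n (by rw [h])
    rcases lt_or_gt_of_ne hne with hlt | hgt
    · have hB := wB_eq n
      have hd := wB_eq (b - wA n)
      have hA : wA (b - wA n) < wA n := wA_strictMono (by omega)
      refine ⟨b - wA n, Or.inl (Or.inr (Or.inr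
        ⟨wA n - wA (b - wA n), by omega, le_min (Nat.sub_le _ _) (by simp only; omega), ?_⟩))⟩
      ext <;> simp only <;> omega
    · refine ⟨n, Or.inl (Or.inr (Or.inl ⟨b - wB n, by omega, Nat.sub_le _ _, ?_⟩))⟩
      ext <;> simp only
      omega
  · have hne : b ≠ wA n := fun h => h₂ n (by rw [h])
    have hB := wB_eq n
    refine ⟨n, Or.inr (Or.inr (Or.inl ⟨b - wA n, by omega, Nat.sub_le _ _, ?_⟩))⟩
    ext <;> simp only
    omega

theorem move_to_wythoff_P (p : ℕ × ℕ)
    (hp : p ∉ ({q : ℕ × ℕ | ∃ n, q = (wA n, wB n)} ∪ {q : ℕ × ℕ | ∃ n, q = (wB n, wA n)})) :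
    ∃ q ∈ ({q : ℕ × ℕ | ∃ n, q = (wA n, wB n)} ∪ {q : ℕ × ℕ | ∃ n, q = (wB n, wA n)}),
      WythoffMove p q := by
  obtain ⟨a, b⟩ := p
  simp only [Set.mem_union, Set.mem_ofPred_eq, not_or, not_exists] at hp
  obtain ⟨h₁, h₂⟩ := hp
  rcases le_total a b with hab | hab
  · obtain ⟨n, h | h⟩ := exists_wythoffMove_of_le hab h₁ h₂
    · exact ⟨_, Or.inl ⟨n, rfl⟩, h⟩
    · exact ⟨_, Or.inr ⟨n, rfl⟩, h⟩
  · obtain ⟨n, h | h⟩ := exists_wythoffMove_of_le hab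
      (fun n h => h₂ n (congrArg Prod.swap h)) (fun n h => h₁ n (congrArg Prod.swap h))
    · exact ⟨_, Or.inr ⟨n, rfl⟩, h.swap⟩
    · exact ⟨_, Or.inl ⟨n, rfl⟩, h.swap⟩
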